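/- In the logic ITL⁰, the formula CD(p,q) → BI(p,q) is derivable, i.e. ITL⁰ ⊢ (□(p∨q) → □p ∨ ◇q) → (□(p∨q) ∧ □(◦q→q) → □p ∨ q). -/

import Mathlib

/-- Formulas of the language `L` of intuitionistic linear temporal logic. -/
inductive Formula : Type
  | bot : Formula
  | var : ℕ → Formula
  | and : Formula → Formula → Formula
  | or : Formula → Formula → Formula
  | impl : Formula → Formula → Formula
  | next : Formula → Formula
  | diam : Formula → Formula
  | box : Formula → Formula
deriving DecidableEq

namespace Formula

/-- `¬φ` abbreviates `φ → ⊥`. -/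
def neg (φ : Formula) : Formula := impl φ bot

/-- `φ ↔ ψ` abbreviates `(φ → ψ) ∧ (ψ → φ)`. -/
def iff (φ ψ : Formula) : Formula := and (impl φ ψ) (impl ψ φ)

end Formula

/-- Derivability in `ITL⁰` extended with an additional set of axioms `Ax`.
The intuitionistic propositional tautologies are generated by a standard
complete Hilbert-style axiomatization of intuitionistic propositional logic
(closed under modus ponens). -/
inductive ITL (Ax : Formula → Prop) : Formula → Prop
  | extra {φ} : Ax φ → ITL Ax φ
  -- (i) intuitionistic propositional axioms
  | then1 (φ ψ : Formula) : ITL Ax (.impl φ (.impl ψ φ))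
  | then2 (φ ψ χ : Formula) :
      ITL Ax (.impl (.impl φ (.impl ψ χ)) (.impl (.impl φ ψ) (.impl φ χ)))
  | andE1 (φ ψ : Formula) : ITL Ax (.impl (.and φ ψ) φ)
  | andE2 (φ ψ : Formula) : ITL Ax (.impl (.and φ ψ) ψ)
  | andI (φ ψ : Formula) : ITL Ax (.impl φ (.impl ψ (.and φ ψ)))
  | orI1 (φ ψ : Formula) : ITL Ax (.impl φ (.or φ ψ))
  | orI2 (φ ψ : Formula) : ITL Ax (.impl ψ (.or φ ψ))
  | orE (φ ψ χ : Formula) :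
      ITL Ax (.impl (.impl φ χ) (.impl (.impl ψ χ) (.impl (.or φ ψ) χ)))
  | botE (φ : Formula) : ITL Ax (.impl .bot φ)
  -- (ii)–(x) temporal axioms
  | nextBot : ITL Ax (.neg (.next .bot))
  | nextAnd (φ ψ : Formula) :
      ITL Ax (.iff (.next (.and φ ψ)) (.and (.next φ) (.next ψ)))
  | nextOr (φ ψ : Formula) :
      ITL Ax (.iff (.next (.or φ ψ)) (.or (.next φ) (.next ψ)))
  | nextK (φ ψ : Formula) :
      ITL Ax (.impl (.next (.impl φ ψ)) (.impl (.next φ) (.next ψ)))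
  | boxK (φ ψ : Formula) :
      ITL Ax (.impl (.box (.impl φ ψ)) (.impl (.box φ) (.box ψ)))
  | diamK (φ ψ : Formula) :
      ITL Ax (.impl (.box (.impl φ ψ)) (.impl (.diam φ) (.diam ψ)))
  | diamOr (φ ψ : Formula) :
      ITL Ax (.impl (.diam (.or φ ψ)) (.or (.diam φ) (.diam ψ)))
  | boxFix (φ : Formula) : ITL Ax (.impl (.box φ) (.and φ (.next (.box φ))))
  | diamFix (φ : Formula) : ITL Ax (.impl (.or φ (.next (.diam φ))) (.diam φ))
  -- rules (xi)–(xiv)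
  | ind1 {φ : Formula} : ITL Ax (.impl φ (.next φ)) → ITL Ax (.impl φ (.box φ))
  | ind2 {φ : Formula} : ITL Ax (.impl (.next φ) φ) → ITL Ax (.impl (.diam φ) φ)
  | mp {φ ψ : Formula} : ITL Ax (.impl φ ψ) → ITL Ax φ → ITL Ax ψ
  | nec {φ : Formula} : ITL Ax φ → ITL Ax (.next φ)

/-- The Fischer Servi axiom schemes FS◦ and FS◇. -/
def FSAx : Formula → Prop := fun χ => ∃ φ ψ : Formula,
  χ = .impl (.impl (.next φ) (.next ψ)) (.next (.impl φ ψ)) ∨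
  χ = .impl (.impl (.diam φ) (.box ψ)) (.box (.impl φ ψ))

/-- The constant domain axiom scheme CD. -/
def CDAx : Formula → Prop := fun χ => ∃ φ ψ : Formula,
  χ = .impl (.box (.or φ ψ)) (.or (.box φ) (.diam ψ))

/-- The logic ITL⁰. -/
def ITL0 : Formula → Prop := ITL (fun _ => False)

/-- The logic ITL^FS = ITL⁰ + FS◦ + FS◇. -/
def ITLFS : Formula → Prop := ITL FSAx

/-- The logic ITL^CD = ITL⁰ + CD. -/
def ITLCD : Formula → Prop := ITL CDAx

/-- The logic ITL¹ = ITL^FS + ITL^CD. -/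
def ITL1 : Formula → Prop := ITL (fun χ => FSAx χ ∨ CDAx χ)

/-- A valuation on a dynamical topological system `(X, T, S)`: a map from
formulas to open sets satisfying the semantic clauses. -/
structure DTValuation (X : Type) (T : TopologicalSpace X) (S : X → X) where
  val : Formula → Set X
  isOpen_val : ∀ φ, @IsOpen X T (val φ)
  val_bot : val .bot = ∅
  val_and : ∀ φ ψ, val (.and φ ψ) = val φ ∩ val ψ
  val_or : ∀ φ ψ, val (.or φ ψ) = val φ ∪ val ψ
  val_impl : ∀ φ ψ, val (.impl φ ψ) = @interior X T ((val φ)ᶜ ∪ val ψ)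
  val_next : ∀ φ, val (.next φ) = S ⁻¹' val φ
  val_diam : ∀ φ, val (.diam φ) = ⋃ n : ℕ, (S^[n]) ⁻¹' val φ
  val_box : ∀ φ, val (.box φ) =
    ⋃₀ {U : Set X | @IsOpen X T U ∧ S '' U ⊆ U ∧ U ⊆ val φ}

/-- The up-set topology of a preorder: the open sets are the upward closed sets. -/
def upsetTopology (X : Type) [Preorder X] : TopologicalSpace X where
  IsOpen U := IsUpperSet U
  isOpen_univ := isUpperSet_univ
  isOpen_inter := fun _ _ hU hV => hU.inter hV
  isOpen_sUnion := fun _ hs => isUpperSet_sUnion hs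

namespace ITL

variable {Ax : Formula → Prop} {φ ψ χ θ : Formula}

/-- A theorem holds under any hypothesis. -/
theorem weaken (h : ITL Ax φ) : ITL Ax (.impl χ φ) := mp (then1 _ _) h

/-- Modus ponens under a hypothesis. -/
theorem mpUnder (h : ITL Ax (.impl χ (.impl φ ψ))) (h' : ITL Ax (.impl χ φ)) :
    ITL Ax (.impl χ ψ) := mp (mp (then2 _ _ _) h) h'

theorem implTrans (h : ITL Ax (.impl φ ψ)) (h' : ITL Ax (.impl ψ χ)) :
    ITL Ax (.impl φ χ) := mpUnder (weaken h') h

theorem curry (h : ITL Ax (.impl (.and φ ψ) χ)) : ITL Ax (.impl φ (.impl ψ χ)) :=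
  implTrans (andI _ _) (mp (then2 _ _ _) (weaken h))

theorem orMapRightUnder (h : ITL Ax (.impl χ (.or φ ψ))) (h' : ITL Ax (.impl χ (.impl ψ θ))) :
    ITL Ax (.impl χ (.or φ θ)) :=
  mpUnder (mpUnder (weaken (mp (orE _ _ _) (orI1 _ _)))
    (implTrans h' (mp (then2 _ _ _) (weaken (orI2 _ _))))) h

theorem boxNec (h : ITL Ax φ) : ITL Ax (.box φ) := mp (ind1 (weaken (nec h))) h

/-- If `◦φ → φ` holds henceforth, then `◇φ` implies `φ`. -/
theorem diamElimOfBox (φ : Formula) :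
    ITL Ax (.impl (.box (.impl (.next φ) φ)) (.impl (.diam φ) φ)) := by
  set B : Formula := .box (.impl (.next φ) φ)
  have step : ITL Ax (.impl (.next (.impl B φ)) (.impl B φ)) :=
    curry (mpUnder (implTrans (andE2 _ _) (implTrans (boxFix _) (andE1 _ _)))
      (mpUnder (implTrans (andE1 _ _) (nextK _ _))
        (implTrans (andE2 _ _) (implTrans (boxFix _) (andE2 _ _)))))
  have main : ITL Ax (.impl (.diam φ) (.impl B φ)) :=
    implTrans (mp (diamK _ _) (boxNec (then1 _ _))) (ind2 step)
  exact curry (mpUnder (implTrans (andE2 _ _) main) (andE1 _ _))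

end ITL

/-- Proposition 1: ITL⁰ ⊢ CD(p,q) → BI(p,q). -/
theorem itl0_derives_CD_implies_BI :
    ITL0 (.impl
      (.impl (.box (.or (.var 0) (.var 1))) (.or (.box (.var 0)) (.diam (.var 1))))
      (.impl
        (.and (.box (.or (.var 0) (.var 1))) (.box (.impl (.next (.var 1)) (.var 1))))
        (.or (.box (.var 0)) (.var 1)))) := by
  exact ITL.curry (ITL.orMapRightUnder
    (ITL.mpUnder (ITL.andE1 _ _) (ITL.implTrans (ITL.andE2 _ _) (ITL.andE1 _ _)))
    (ITL.implTrans (ITL.andE2 _ _) (ITL.implTrans (ITL.andE2 _ _) (ITL.diamElimOfBox _))))
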